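/- The function a(r) = 96√2 + (8/9)·(3-r)·(r²+4r+9)·√(3(r²-2r+9)), defined for r > 0, has exactly one zero in (0,∞); moreover a(r) > 0 for 0 < r ≤ 3, a is strictly decreasing on (3,∞) and tends to -∞ as r → +∞, and the unique zero of a coincides with the unique positive real root of the sextic χ₁(r) = r⁶+2r⁵+r⁴-36r³-45r²-270r-405. -/

import Mathlib

/-- The coefficient `a₃⁽¹⁾` in the edge problem for isohedral triakis tetrahedra. -/
noncomputable def a (r : ℝ) : ℝ :=
  96 * Real.sqrt 2 +
    (8 / 9) * (3 - r) * (r ^ 2 + 4 * r + 9) * Real.sqrt (3 * (r ^ 2 - 2 * r + 9))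

/-- The sextic polynomial arising in the edge problem for isohedral triakis
tetrahedra. -/
noncomputable def χ₁ (r : ℝ) : ℝ :=
  r ^ 6 + 2 * r ^ 5 + r ^ 4 - 36 * r ^ 3 - 45 * r ^ 2 - 270 * r - 405

theorem a_pos_of_le_three {r : ℝ} (h0 : 0 < r) (h3 : r ≤ 3) : 0 < a r := by
  have h : 0 ≤ 3 - r := sub_nonneg.2 h3
  unfold a
  positivity

theorem χ₁_neg_of_le_three {r : ℝ} (h0 : 0 < r) (h3 : r ≤ 3) : χ₁ r < 0 := by
  have h : 0 ≤ 3 - r := sub_nonneg.2 h3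
  have h₁ : 0 ≤ r ^ 3 * ((3 - r) * (r ^ 2 + 5 * r + 16)) := by positivity
  have h₂ : 0 ≤ r ^ 2 * (3 - r) := by positivity
  have h₃ : 0 ≤ r * (3 - r) := by positivity
  unfold χ₁
  nlinarith

theorem cubic_factor_lt {x y : ℝ} (hx : 3 ≤ x) (hxy : x < y) :
    (x - 3) * (x ^ 2 + 4 * x + 9) < (y - 3) * (y ^ 2 + 4 * y + 9) := by
  have h : x ^ 2 + 4 * x + 9 ≤ y ^ 2 + 4 * y + 9 := by nlinarith
  have hy : 0 < y ^ 2 + 4 * y + 9 := by nlinarith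
  calc (x - 3) * (x ^ 2 + 4 * x + 9) ≤ (x - 3) * (y ^ 2 + 4 * y + 9) :=
        mul_le_mul_of_nonneg_left h (by linarith)
    _ < (y - 3) * (y ^ 2 + 4 * y + 9) := mul_lt_mul_of_pos_right (by linarith) hy

theorem a_strictAntiOn : StrictAntiOn a (Set.Ioi (3 : ℝ)) := by
  intro x hx y _ hxy
  have hx : 3 < x := hx
  have hp := cubic_factor_lt hx.le hxy
  have hs : √(3 * (x ^ 2 - 2 * x + 9)) ≤ √(3 * (y ^ 2 - 2 * y + 9)) :=
    Real.sqrt_le_sqrt (by nlinarith)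
  have hx0 : 0 < √(3 * (x ^ 2 - 2 * x + 9)) := Real.sqrt_pos.2 (by nlinarith)
  have hy0 : 0 ≤ (y - 3) * (y ^ 2 + 4 * y + 9) :=
    mul_nonneg (by linarith) (by nlinarith)
  have := mul_lt_mul hp hs hx0 hy0
  unfold a
  linarith

theorem a_tendsto_atBot : Filter.Tendsto a Filter.atTop Filter.atBot := by
  have hlin : Filter.Tendsto (fun r : ℝ => (96 * √2 + 3) - r) Filter.atTop Filter.atBot :=
    Filter.tendsto_atBot_add_const_left _ _ Filter.tendsto_neg_atTop_atBot
  refine Filter.tendsto_atBot_mono' _ ?_ hlin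
  filter_upwards [Filter.eventually_ge_atTop 3] with r hr
  have hs : 1 ≤ √(3 * (r ^ 2 - 2 * r + 9)) := Real.one_le_sqrt.2 (by nlinarith)
  have hq : 1 ≤ 8 / 9 * (r ^ 2 + 4 * r + 9) := by nlinarith
  have := mul_le_mul_of_nonneg_left (one_le_mul_of_one_le_of_one_le hq hs)
    (sub_nonneg.2 hr)
  unfold a
  linarith

theorem a_eq_zero_iff_χ₁_eq_zero {r : ℝ} (hr : 0 < r) : a r = 0 ↔ χ₁ r = 0 := by
  rcases le_or_gt r 3 with h3 | h3
  · exact iff_of_false (a_pos_of_le_three hr h3).ne' (χ₁_neg_of_le_three hr h3).ne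
  have hq : 0 < r ^ 2 - 2 * r + 3 := by nlinarith
  have hs : √(3 * (r ^ 2 - 2 * r + 9)) ^ 2 = 3 * (r ^ 2 - 2 * r + 9) :=
    Real.sq_sqrt (by nlinarith)
  have h2 : √2 ^ 2 = (2 : ℝ) := Real.sq_sqrt (by norm_num)
  have h : 0 ≤ r - 3 := by linarith
  have hsq : (8 / 9 * (r - 3) * (r ^ 2 + 4 * r + 9) * √(3 * (r ^ 2 - 2 * r + 9))) ^ 2
      - (96 * √2) ^ 2 = 64 / 27 * (χ₁ r * (r ^ 2 - 2 * r + 3)) := by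
    rw [mul_pow, hs, mul_pow 96, h2, χ₁]
    ring
  calc a r = 0
      ↔ 8 / 9 * (r - 3) * (r ^ 2 + 4 * r + 9) * √(3 * (r ^ 2 - 2 * r + 9)) = 96 * √2 := by
        unfold a
        constructor <;> intro h <;> linarith
    _ ↔ _ ^ 2 = (96 * √2) ^ 2 := (sq_eq_sq₀ (by positivity) (by positivity)).symm
    _ ↔ χ₁ r = 0 := by
        rw [← sub_eq_zero, hsq]
        simp [hq.ne']

theorem a_four_neg : a 4 < 0 := by
  have h₁ : √2 ≤ (2 : ℝ) := Real.sqrt_le_iff.2 (by norm_num)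
  have h₂ : 7 ≤ √(3 * ((4 : ℝ) ^ 2 - 2 * 4 + 9)) := Real.le_sqrt_of_sq_le (by norm_num)
  unfold a
  norm_num at h₂ ⊢
  linarith

theorem coefficient_a3_edge_tetrahedron :
    (∀ r : ℝ, 0 < r → r ≤ 3 → 0 < a r) ∧
    StrictAntiOn a (Set.Ioi (3 : ℝ)) ∧
    Filter.Tendsto a Filter.atTop Filter.atBot ∧
    ∃ x : ℝ, 0 < x ∧ a x = 0 ∧ (∀ y : ℝ, 0 < y → a y = 0 → y = x) ∧
      χ₁ x = 0 ∧ (∀ y : ℝ, 0 < y → χ₁ y = 0 → y = x) := by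
  have hcont : Continuous a := by
    unfold a
    fun_prop
  obtain ⟨x, hx, hax⟩ : (0 : ℝ) ∈ a '' Set.Icc 3 4 :=
    intermediate_value_Icc' (by norm_num) hcont.continuousOn
      ⟨a_four_neg.le, (a_pos_of_le_three (by norm_num) le_rfl).le⟩
  have gt_three {y : ℝ} (hy : 0 < y) (hay : a y = 0) : 3 < y :=
    lt_of_not_ge fun h => (a_pos_of_le_three hy h).ne' hay
  have hx0 : 0 < x := by linarith [hx.1]
  have huniq (y : ℝ) (hy : 0 < y) (hay : a y = 0) : y = x :=
    a_strictAntiOn.injOn (gt_three hy hay) (gt_three hx0 hax) (hay.trans hax.symm)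
  exact ⟨fun _ => a_pos_of_le_three, a_strictAntiOn, a_tendsto_atBot, x, hx0, hax, huniq,
    (a_eq_zero_iff_χ₁_eq_zero hx0).1 hax,
    fun y hy h => huniq y hy ((a_eq_zero_iff_χ₁_eq_zero hy).2 h)⟩
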